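/- arXiv:1207.5748 — 2 statements merged into one kernel-verified Lean document; each statement's English description precedes it below -/
import Mathlib

section
/- Let k be a positive even integer, d a positive integer, and λ = (λ_1 ≥ … ≥ λ_l > 0) a partition of dk all of whose parts are even and which has at most d parts. Let N ≥ λ_1 and W = ℂ^N. Then there exists a nonzero vector v in the d-fold tensor power (⋀^k W)^{⊗d} such that: (i) v is invariant under the action of the symmetric group S_d permuting the tensor factors; (ii) for every N×N upper triangular matrix g with all diagonal entries equal to 1, the map (⋀^k g)^{⊗d} fixes v; (iii) for every tuple t = (t_1,…,t_N) of nonzero complex numbers, the map (⋀^k diag(t_1,…,t_N))^{⊗d} sends v to (∏_{i=1}^N t_i^{λ*_i})·v, where λ* is the conjugate partition of λ, given by λ*_i = #{j : λ_j ≥ i} (and λ*_i = 0 for i > λ_1). (Equivalently, the Schur module S_{λ*}W occurs with positive multiplicity in the symmetric power S^d(⋀^k W).) -/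
open scoped TensorProduct

set_option synthInstance.maxHeartbeats 1000000
set_option maxHeartbeats 1000000

noncomputable section

/-- The endomorphism of the `k`-th exterior power `⋀[ℂ]^k W` (realized as a submodule of the
exterior algebra) induced by a linear endomorphism `f` of `W`. -/
def exteriorPowerMap {N : Type*} [AddCommGroup N] [Module ℂ N] (k : ℕ)
    (f : N →ₗ[ℂ] N) : ⋀[ℂ]^k N →ₗ[ℂ] ⋀[ℂ]^k N :=
  LinearMap.restrict (ExteriorAlgebra.map f).toLinearMap
    (fun x hx => by
      have h : Submodule.map (ExteriorAlgebra.map f).toLinearMap (⋀[ℂ]^k N) ≤ ⋀[ℂ]^k N := by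
        rw [ExteriorAlgebra.exteriorPower, Submodule.map_pow, ExteriorAlgebra.ι_range_map_map]
        exact pow_le_pow_left' LinearMap.map_le_range k
      exact h ⟨x, hx, rfl⟩)


namespace Wein

open Equiv

variable {k d N : ℕ}

lemma epm_ιMulti (f : (Fin N → ℂ) →ₗ[ℂ] (Fin N → ℂ)) (w : Fin k → (Fin N → ℂ)) :
    exteriorPowerMap k f (exteriorPower.ιMulti ℂ k w) =
      exteriorPower.ιMulti ℂ k (fun b => f (w b)) := by
  apply Subtype.ext
  simp only [exteriorPowerMap, LinearMap.coe_restrict_apply, exteriorPower.ιMulti_apply_coe]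
  exact ExteriorAlgebra.map_apply_ιMulti f w

/-- The multilinear map sending a `d × k` array of vectors to the tensor of the row wedges. -/
def G0 (k d N : ℕ) : MultilinearMap ℂ (fun _ : Fin d × Fin k => (Fin N → ℂ))
    (⨂[ℂ]^d (⋀[ℂ]^k (Fin N → ℂ))) :=
  MultilinearMap.mk' (fun w => PiTensorProduct.tprod ℂ
      (fun a : Fin d => exteriorPower.ιMulti ℂ k (fun b => w (a, b))))
    (by
      have key : ∀ (w : Fin d × Fin k → (Fin N → ℂ)) (p : Fin d × Fin k) (x : Fin N → ℂ),
          (fun a : Fin d => exteriorPower.ιMulti ℂ k (fun b => Function.update w p x (a, b))) =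
          Function.update (fun a : Fin d => exteriorPower.ιMulti ℂ k (fun b => w (a, b))) p.1
            (exteriorPower.ιMulti ℂ k (Function.update (fun b => w (p.1, b)) p.2 x)) := by
        intro w p x
        funext a
        by_cases h : a = p.1
        · subst h
          rw [Function.update_self]
          congr 1
          funext b
          by_cases hb : b = p.2
          · subst hb; simp
          · rw [Function.update_of_ne hb, Function.update_of_ne]
            intro h; exact hb (by rw [← h])
        · rw [Function.update_of_ne h]
          congr 1
          funext b
          rw [Function.update_of_ne]
          intro h'; exact h (by rw [← h'])
      intro w p x y
      rw [key, key, key, AlternatingMap.map_update_add, MultilinearMap.map_update_add])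
    (by
      have key : ∀ (w : Fin d × Fin k → (Fin N → ℂ)) (p : Fin d × Fin k) (x : Fin N → ℂ),
          (fun a : Fin d => exteriorPower.ιMulti ℂ k (fun b => Function.update w p x (a, b))) =
          Function.update (fun a : Fin d => exteriorPower.ιMulti ℂ k (fun b => w (a, b))) p.1
            (exteriorPower.ιMulti ℂ k (Function.update (fun b => w (p.1, b)) p.2 x)) := by
        intro w p x
        funext a
        by_cases h : a = p.1
        · subst h
          rw [Function.update_self]
          congr 1
          funext b
          by_cases hb : b = p.2
          · subst hb; simp
          · rw [Function.update_of_ne hb, Function.update_of_ne]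
            intro h; exact hb (by rw [← h])
        · rw [Function.update_of_ne h]
          congr 1
          funext b
          rw [Function.update_of_ne]
          intro h'; exact h (by rw [← h'])
      intro w p c x
      rw [key, key, AlternatingMap.map_update_smul, MultilinearMap.map_update_smul])

lemma G0_apply (w : Fin d × Fin k → (Fin N → ℂ)) : G0 k d N w = PiTensorProduct.tprod ℂ
      (fun a : Fin d => exteriorPower.ιMulti ℂ k (fun b => w (a, b))) := rfl

lemma map_G0 (f : (Fin N → ℂ) →ₗ[ℂ] (Fin N → ℂ)) (w : Fin d × Fin k → (Fin N → ℂ)) :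
    PiTensorProduct.map (fun _ : Fin d => exteriorPowerMap k f) (G0 k d N w) =
      G0 k d N (fun p => f (w p)) := by
  rw [G0_apply, G0_apply, PiTensorProduct.map_tprod]
  simp only [epm_ιMulti]

/-- Coefficient of the term of a permutation. -/
def cf (row : Fin d × Fin k → ℕ) (π : Perm (Fin d × Fin k)) : ℂ :=
  ((Perm.sign π : ℤ) : ℂ) * ∏ p : Fin d × Fin k, ((p.1 : ℕ) : ℂ) ^ row (π p)

/-- The antisymmetrised multilinear map. -/
def F (N : ℕ) (row : Fin d × Fin k → ℕ) :
    MultilinearMap ℂ (fun _ : Fin d × Fin k => (Fin N → ℂ)) (⨂[ℂ]^d (⋀[ℂ]^k (Fin N → ℂ))) :=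
  ∑ π : Perm (Fin d × Fin k), cf row π • (G0 k d N).domDomCongr π

lemma F_apply (row : Fin d × Fin k → ℕ) (w : Fin d × Fin k → (Fin N → ℂ)) :
    F N row w = ∑ π : Perm (Fin d × Fin k), cf row π • G0 k d N (fun p => w (π p)) := by
  rw [F, sum_apply]
  rfl

lemma map_F (row : Fin d × Fin k → ℕ) (f : (Fin N → ℂ) →ₗ[ℂ] (Fin N → ℂ))
    (w : Fin d × Fin k → (Fin N → ℂ)) :
    PiTensorProduct.map (fun _ : Fin d => exteriorPowerMap k f) (F N row w) =
      F N row (fun p => f (w p)) := by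
  rw [F_apply, F_apply, map_sum]
  simp only [map_smul, map_G0]

lemma F_eq_zero (row : Fin d × Fin k → ℕ) (w : Fin d × Fin k → (Fin N → ℂ))
    {p q : Fin d × Fin k} (hpq : p ≠ q) (hr : row p = row q) (hw : w p = w q) :
    F N row w = 0 := by
  have hrow : ∀ x, row (swap p q x) = row x := by
    intro x
    by_cases h1 : x = p
    · subst h1; simp [hr]
    · by_cases h2 : x = q
      · subst h2; simp [hr]
      · rw [swap_apply_of_ne_of_ne h1 h2]
  have hww : ∀ x, w (swap p q x) = w x := by
    intro x
    by_cases h1 : x = p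
    · subst h1; simp [hw]
    · by_cases h2 : x = q
      · subst h2; simp [hw]
      · rw [swap_apply_of_ne_of_ne h1 h2]
  have h : F N row w = (-1 : ℂ) • F N row w := by
    conv_lhs => rw [F_apply, ← Equiv.sum_comp (Equiv.mulLeft (swap p q))]
    rw [F_apply, Finset.smul_sum]
    refine Finset.sum_congr rfl fun π _ => ?_
    rw [smul_smul]
    congr 1
    · simp only [cf, Equiv.coe_mulLeft, Perm.mul_apply, hrow, Perm.sign_mul, Perm.sign_swap hpq]
      simp
    · simp only [Equiv.coe_mulLeft, Perm.mul_apply, hww]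
  have h2 : (2 : ℂ) • F N row w = 0 := by
    calc (2 : ℂ) • F N row w = F N row w + F N row w := two_smul _ _
      _ = (1 : ℂ) • F N row w + (-1 : ℂ) • F N row w := by rw [one_smul, ← h]
      _ = 0 := by rw [← add_smul]; simp
  calc F N row w = (2⁻¹ : ℂ) • (2 : ℂ) • F N row w := by rw [smul_smul]; simp
    _ = 0 := by rw [h2, smul_zero]

/-- The candidate highest weight vector before symmetrisation. -/
def v0 (row : Fin d × Fin k → ℕ) (col : Fin d × Fin k → Fin N) :
    ⨂[ℂ]^d (⋀[ℂ]^k (Fin N → ℂ)) := F N row (fun p => Pi.single (col p) 1)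

lemma map_v0 (row : Fin d × Fin k → ℕ) (col : Fin d × Fin k → Fin N)
    (g : Matrix (Fin N) (Fin N) ℂ) :
    PiTensorProduct.map (fun _ : Fin d => exteriorPowerMap k (Matrix.toLin' g)) (v0 row col) =
      ∑ h : Fin d × Fin k → Fin N, (∏ p, g (h p) (col p)) • v0 row h := by
  rw [v0, map_F]
  have : (fun p : Fin d × Fin k => Matrix.toLin' g (Pi.single (col p) 1)) =
      fun p => ∑ c : Fin N, g c (col p) • (Pi.single c (1 : ℂ) : Fin N → ℂ) := by
    funext p
    rw [Matrix.toLin'_apply, Matrix.mulVec_single_one]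
    funext c
    simp [Finset.sum_apply, Pi.single_apply]
  rw [this, MultilinearMap.map_sum]
  refine Finset.sum_congr rfl fun h _ => ?_
  exact MultilinearMap.map_smul_univ _ _ _

lemma unip_v0 (row : Fin d × Fin k → ℕ) (col : Fin d × Fin k → Fin N)
    (hrc : ∀ p, ∀ c : Fin N, c < col p → ∃ q, row q = row p ∧ col q = c)
    (g : Matrix (Fin N) (Fin N) ℂ) (hg : ∀ i j : Fin N, j < i → g i j = 0)
    (hg1 : ∀ i, g i i = 1) :
    PiTensorProduct.map (fun _ : Fin d => exteriorPowerMap k (Matrix.toLin' g)) (v0 row col) =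
      v0 row col := by
  rw [map_v0, Finset.sum_eq_single col]
  · simp [hg1]
  · intro h _ hne
    by_cases hle : ∀ p, h p ≤ col p
    · by_cases hinj : ∃ p q, p ≠ q ∧ row p = row q ∧ h p = h q
      · obtain ⟨p, q, hpq, hr, hh⟩ := hinj
        rw [v0, F_eq_zero row _ hpq hr (by simp only [hh]), smul_zero]
      · exfalso
        apply hne
        have key : ∀ n : ℕ, ∀ p, (col p : ℕ) = n → h p = col p := by
          intro n
          induction n using Nat.strong_induction_on with
          | _ n ih =>
            intro p hp
            by_contra hlt
            have hlt : h p < col p := lt_of_le_of_ne (hle p) hlt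
            obtain ⟨q, hq1, hq2⟩ := hrc p (h p) hlt
            have := ih (col q) (by rw [hq2, ← hp]; exact hlt) q rfl
            apply hinj
            refine ⟨p, q, ?_, hq1.symm, by rw [this, hq2]⟩
            rintro rfl
            rw [hq2] at hlt
            exact lt_irrefl _ hlt
        funext p
        exact key _ p rfl
    · push Not at hle
      obtain ⟨p, hp⟩ := hle
      rw [Finset.prod_eq_zero (Finset.mem_univ p) (hg _ _ hp), zero_smul]
  · simp

lemma diag_v0 (row : Fin d × Fin k → ℕ) (col : Fin d × Fin k → Fin N) (t : Fin N → ℂ) :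
    PiTensorProduct.map (fun _ : Fin d => exteriorPowerMap k (Matrix.toLin' (Matrix.diagonal t)))
      (v0 row col) = (∏ p, t (col p)) • v0 row col := by
  rw [map_v0, Finset.sum_eq_single col]
  · simp
  · intro h _ hne
    obtain ⟨p, hp⟩ := Function.ne_iff.mp hne
    have h0 : ∏ p, (Matrix.diagonal t : Matrix (Fin N) (Fin N) ℂ) (h p) (col p) = 0 :=
      Finset.prod_eq_zero (Finset.mem_univ p) (Matrix.diagonal_apply_ne t hp)
    rw [h0, zero_smul]
  · simp

/-- Symmetrisation. -/
def sy (v : ⨂[ℂ]^d (⋀[ℂ]^k (Fin N → ℂ))) : ⨂[ℂ]^d (⋀[ℂ]^k (Fin N → ℂ)) :=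
  ∑ σ : Perm (Fin d), PiTensorProduct.reindex ℂ (fun _ : Fin d => ⋀[ℂ]^k (Fin N → ℂ)) σ v

lemma reindex_sy (v : ⨂[ℂ]^d (⋀[ℂ]^k (Fin N → ℂ))) (τ : Perm (Fin d)) :
    PiTensorProduct.reindex ℂ (fun _ : Fin d => ⋀[ℂ]^k (Fin N → ℂ)) τ (sy v) = sy v := by
  rw [sy, map_sum]
  rw [← Equiv.sum_comp (Equiv.mulLeft τ)
    (fun σ => PiTensorProduct.reindex ℂ (fun _ : Fin d => ⋀[ℂ]^k (Fin N → ℂ)) σ v)]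
  refine Finset.sum_congr rfl fun σ _ => ?_
  exact LinearEquiv.congr_fun
    (PiTensorProduct.reindex_trans (R := ℂ) (s := fun _ : Fin d => ⋀[ℂ]^k (Fin N → ℂ)) σ τ) v

lemma map_sy (v : ⨂[ℂ]^d (⋀[ℂ]^k (Fin N → ℂ)))
    (f : ⋀[ℂ]^k (Fin N → ℂ) →ₗ[ℂ] ⋀[ℂ]^k (Fin N → ℂ)) :
    PiTensorProduct.map (fun _ : Fin d => f) (sy v) =
      sy (PiTensorProduct.map (fun _ : Fin d => f) v) := by
  rw [sy, sy, map_sum]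
  refine Finset.sum_congr rfl fun σ _ => ?_
  exact PiTensorProduct.map_reindex (fun _ : Fin d => f) σ v

lemma sy_smul (c : ℂ) (v : ⨂[ℂ]^d (⋀[ℂ]^k (Fin N → ℂ))) : sy (c • v) = c • sy v := by
  simp only [sy, map_smul, Finset.smul_sum]

/-- The product functional. -/
def Φ (d : ℕ) (φ : ⋀[ℂ]^k (Fin N → ℂ) →ₗ[ℂ] ℂ) : (⨂[ℂ]^d (⋀[ℂ]^k (Fin N → ℂ))) →ₗ[ℂ] ℂ :=
  PiTensorProduct.lift ((MultilinearMap.mkPiAlgebra ℂ (Fin d) ℂ).compLinearMap (fun _ => φ))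

lemma Φ_tprod (φ : ⋀[ℂ]^k (Fin N → ℂ) →ₗ[ℂ] ℂ) (x : Fin d → ⋀[ℂ]^k (Fin N → ℂ)) :
    Φ d φ (PiTensorProduct.tprod ℂ x) = ∏ a, φ (x a) := by
  rw [Φ, PiTensorProduct.lift.tprod]
  simp

lemma Φ_reindex (φ : ⋀[ℂ]^k (Fin N → ℂ) →ₗ[ℂ] ℂ) (σ : Perm (Fin d))
    (v : ⨂[ℂ]^d (⋀[ℂ]^k (Fin N → ℂ))) :
    Φ d φ (PiTensorProduct.reindex ℂ (fun _ : Fin d => ⋀[ℂ]^k (Fin N → ℂ)) σ v) = Φ d φ v := by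
  have : (Φ d φ) ∘ₗ (PiTensorProduct.reindex ℂ (fun _ : Fin d => ⋀[ℂ]^k (Fin N → ℂ)) σ).toLinearMap
      = Φ d φ := by
    apply PiTensorProduct.ext
    ext x
    simp only [LinearMap.compMultilinearMap_apply, LinearMap.comp_apply, LinearEquiv.coe_coe]
    erw [PiTensorProduct.reindex_tprod, Φ_tprod, Φ_tprod]
    exact Equiv.prod_comp σ.symm (fun a => φ (x a))
  exact LinearMap.congr_fun this v

lemma Φ_sy (φ : ⋀[ℂ]^k (Fin N → ℂ) →ₗ[ℂ] ℂ) (v : ⨂[ℂ]^d (⋀[ℂ]^k (Fin N → ℂ))) :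
    Φ d φ (sy v) = (Fintype.card (Perm (Fin d)) : ℂ) * Φ d φ v := by
  rw [sy, map_sum]
  simp only [Φ_reindex]
  simp

/-! ### The sum of squares -/

section squares

variable {L : ℕ} {c : Fin L → ℕ}

/-- Half cells. -/
abbrev H (c : Fin L → ℕ) := (i : Fin L) × Fin (c i)

/-- Row index of a cell. -/
def rw' : H c ⊕ H c → ℕ := Sum.elim (fun x => x.2) (fun x => x.2)

/-- The pairing of cells. -/
def BB : H c ⊕ H c → H c ⊕ H c → ℂ
  | Sum.inl x, Sum.inr y => if x.1 = y.1 then 1 else 0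
  | _, _ => 0

/-- Signed monomials. -/
def ff (lab : H c → ℕ) (π : Perm (H c)) : ℝ :=
  ((Perm.sign π : ℤ) : ℝ) * ∏ x, (lab x : ℝ) ^ ((π x).2 : ℕ)

/-- The full term. -/
def TT (lab : H c → ℕ) (π : Perm (H c ⊕ H c)) : ℂ :=
  ((Perm.sign π : ℤ) : ℂ) * (∏ x, ((lab x : ℂ) ^ rw' (π (Sum.inl x)) *
    (lab x : ℂ) ^ rw' (π (Sum.inr x)))) * ∏ x, BB (π (Sum.inl x)) (π (Sum.inr x))

lemma TT_sumCongr (lab : H c → ℕ) (π₀ π₁ : Perm (H c)) :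
    TT lab (Perm.sumCongr π₀ π₁) = ((ff lab π₀ * ff lab π₁ *
      (if (fun x => (π₀ x).1) = (fun x => (π₁ x).1) then 1 else 0) : ℝ) : ℂ) := by
  have h1 : ∏ x, BB (Perm.sumCongr π₀ π₁ (Sum.inl x)) (Perm.sumCongr π₀ π₁ (Sum.inr x)) =
      if (fun x => (π₀ x).1) = (fun x => (π₁ x).1) then (1 : ℂ) else 0 := by
    simp only [Perm.sumCongr_apply, Sum.map_inl, Sum.map_inr, BB]
    rw [Finset.prod_ite_zero]
    simp [funext_iff]
  rw [TT, h1, Perm.sign_sumCongr, Finset.prod_mul_distrib]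
  simp only [Perm.sumCongr_apply, Sum.map_inl, Sum.map_inr, rw', Sum.elim_inl, Sum.elim_inr, ff]
  split_ifs <;> push_cast <;> ring

lemma sum_TT (lab : H c → ℕ) : ∑ π, TT lab π = ((∑ p : Perm (H c) × Perm (H c),
    ff lab p.1 * ff lab p.2 *
      (if (fun x => (p.1 x).1) = (fun x => (p.2 x).1) then 1 else 0) : ℝ) : ℂ) := by
  rw [Complex.ofReal_sum]
  symm
  refine Finset.sum_of_injOn (fun p => Perm.sumCongrHom (H c) (H c) p) ?_ ?_ ?_ ?_
  · exact Perm.sumCongrHom_injective.injOn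
  · intro _ _; simp
  · intro π _ hπ
    by_cases h : Set.MapsTo π (Set.range Sum.inl) (Set.range Sum.inl)
    · exfalso
      apply hπ
      obtain ⟨p, hp⟩ := Perm.mem_sumCongrHom_range_of_perm_mapsTo_inl h
      exact ⟨p, by simp, hp⟩
    · simp only [Set.MapsTo, Set.mem_range, forall_exists_index, forall_apply_eq_imp_iff] at h
      push Not at h
      obtain ⟨x, hx⟩ := h
      have h0 : ∏ x, BB (π (Sum.inl x)) (π (Sum.inr x)) = 0 := by
        refine Finset.prod_eq_zero (Finset.mem_univ x) ?_
        rcases h2 : π (Sum.inl x) with y | y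
        · exact absurd h2.symm (hx y)
        · rfl
      rw [TT, h0, mul_zero]
  · intro p _
    exact (TT_sumCongr lab p.1 p.2).symm

lemma sum_sq (lab : H c → ℕ) : (∑ p : Perm (H c) × Perm (H c),
    ff lab p.1 * ff lab p.2 *
      (if (fun x => (p.1 x).1) = (fun x => (p.2 x).1) then 1 else 0) : ℝ) =
    ∑ ι : H c → Fin L, (∑ π : Perm (H c), if (fun x => (π x).1) = ι then ff lab π else 0) ^ 2 := by
  rw [Fintype.sum_prod_type]
  simp_rw [sq, Finset.sum_mul_sum]
  symm
  rw [Finset.sum_comm]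
  refine Finset.sum_congr rfl fun π₀ _ => ?_
  rw [Finset.sum_comm]
  refine Finset.sum_congr rfl fun π₁ _ => ?_
  rw [Finset.sum_eq_single (fun x => (π₀ x).1)]
  · by_cases h : (fun x => (π₀ x).1) = (fun x => (π₁ x).1)
    · simp [h]
    · simp [h, Ne.symm h]
  · intro ι _ h
    simp [Ne.symm h]
  · simp

lemma det_ne (lab : H c → ℕ) (hlab : ∀ x y : H c, x.1 = y.1 → lab x = lab y → x = y) :
    (∑ π : Perm (H c), if (fun x => (π x).1) = (fun x => x.1) then ff lab π else 0) ≠ 0 := by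
  have h : (∑ π : Perm (H c), if (fun x => (π x).1) = (fun x => x.1) then ff lab π else 0) =
      (Matrix.blockDiagonal' (fun i : Fin L =>
        Matrix.vandermonde (fun j : Fin (c i) => (lab ⟨i, j⟩ : ℝ)))).det := by
    rw [← Matrix.det_transpose, Matrix.det_apply']
    refine Finset.sum_congr rfl fun π _ => ?_
    by_cases h : (fun x => (π x).1) = (fun x => x.1)
    · rw [if_pos h, ff]
      congr 1
      refine Finset.prod_congr rfl fun x _ => ?_
      have hx := congrFun h x
      rw [Matrix.transpose_apply]
      generalize π x = y at hx
      obtain ⟨i, j⟩ := x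
      obtain ⟨i', j'⟩ := y
      simp only at hx
      subst hx
      rw [Matrix.blockDiagonal'_apply_eq, Matrix.vandermonde_apply]
    · rw [if_neg h]
      obtain ⟨x, hx⟩ := Function.ne_iff.mp h
      rw [Finset.prod_eq_zero (Finset.mem_univ x), mul_zero]
      rw [Matrix.transpose_apply]
      exact Matrix.blockDiagonal'_apply_ne _ _ _ (Ne.symm hx)
  have hv : ∀ i : Fin L,
      (Matrix.vandermonde (fun j : Fin (c i) => (lab ⟨i, j⟩ : ℝ))).det ≠ 0 := by
    intro i
    rw [Matrix.det_vandermonde_ne_zero_iff]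
    intro j j' hj
    have := hlab ⟨i, j⟩ ⟨i, j'⟩ rfl (by simpa using hj)
    simpa using this
  rw [h]
  refine Matrix.det_ne_zero_of_right_inverse (B := Matrix.blockDiagonal' (fun i : Fin L =>
        (Matrix.vandermonde (fun j : Fin (c i) => (lab ⟨i, j⟩ : ℝ)))⁻¹)) ?_
  rw [← Matrix.blockDiagonal'_mul, ← Matrix.blockDiagonal'_one]
  congr 1
  funext i
  exact Matrix.mul_nonsing_inv _ (isUnit_iff_ne_zero.mpr (hv i))

lemma sum_TT_ne (lab : H c → ℕ) (hlab : ∀ x y : H c, x.1 = y.1 → lab x = lab y → x = y) :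
    ∑ π, TT lab π ≠ 0 := by
  rw [sum_TT, sum_sq, Complex.ofReal_ne_zero]
  apply ne_of_gt
  refine Finset.sum_pos' (fun ι _ => sq_nonneg _) ⟨fun x => x.1, Finset.mem_univ _, ?_⟩
  exact sq_pos_of_ne_zero (det_ne lab hlab)

end squares


/-! ### The functional -/

section functional

variable {m : ℕ}

/-- Multilinear functional with prescribed values on basis vectors. -/
def MM (k N : ℕ) (B : (Fin k → Fin N) → ℂ) : MultilinearMap ℂ (fun _ : Fin k => (Fin N → ℂ)) ℂ :=
  ∑ f : Fin k → Fin N, B f • (MultilinearMap.mkPiAlgebra ℂ (Fin k) ℂ).compLinearMap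
    (fun b => LinearMap.proj (f b))

lemma MM_basis (B : (Fin k → Fin N) → ℂ) (f : Fin k → Fin N) :
    MM k N B (fun b => Pi.single (f b) 1) = B f := by
  rw [MM, sum_apply, Finset.sum_eq_single f]
  · simp
  · intro f' _ hne
    obtain ⟨b, hb⟩ := Function.ne_iff.mp hne
    simp only [smul_apply, MultilinearMap.compLinearMap_apply,
      MultilinearMap.mkPiAlgebra_apply, LinearMap.proj_apply, smul_eq_mul]
    rw [Finset.prod_eq_zero (Finset.mem_univ b), mul_zero]
    exact Pi.single_eq_of_ne hb 1
  · simp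

/-- The functional on the exterior power. -/
def phi (k N : ℕ) (B : (Fin k → Fin N) → ℂ) : ⋀[ℂ]^k (Fin N → ℂ) →ₗ[ℂ] ℂ :=
  exteriorPower.alternatingMapLinearEquiv (MultilinearMap.alternatization (MM k N B))

lemma phi_basis (B : (Fin k → Fin N) → ℂ) (f : Fin k → Fin N) :
    phi k N B (exteriorPower.ιMulti ℂ k (fun b => Pi.single (f b) 1)) =
      ∑ τ : Perm (Fin k), ((Perm.sign τ : ℤ) : ℂ) * B (fun b => f (τ b)) := by
  rw [phi, exteriorPower.alternatingMapLinearEquiv_apply_ιMulti,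
    MultilinearMap.alternatization_apply]
  refine Finset.sum_congr rfl fun τ _ => ?_
  rw [MultilinearMap.domDomCongr_apply, MM_basis B (fun b => f (τ b))]
  rw [Units.smul_def, zsmul_eq_mul]

lemma cf_mul (row : Fin d × Fin k → ℕ) (π : Perm (Fin d × Fin k)) (τ : Fin d → Perm (Fin k)) :
    cf row (π * prodCongrRight τ) = cf row π * ∏ a, ((Perm.sign (τ a) : ℤ) : ℂ) := by
  have h : ∏ p : Fin d × Fin k, ((p.1 : ℕ) : ℂ) ^ row ((π * prodCongrRight τ) p) =
      ∏ p : Fin d × Fin k, ((p.1 : ℕ) : ℂ) ^ row (π p) := by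
    rw [← Equiv.prod_comp (prodCongrRight τ)
      (fun p : Fin d × Fin k => ((p.1 : ℕ) : ℂ) ^ row (π p))]
    rfl
  rw [cf, cf, h, Perm.sign_mul, Perm.sign_prodCongrRight]
  push_cast
  ring

lemma Φ_v0 (B : (Fin k → Fin N) → ℂ) (row : Fin d × Fin k → ℕ) (col : Fin d × Fin k → Fin N) :
    Φ d (phi k N B) (v0 row col) = (Fintype.card (Fin d → Perm (Fin k)) : ℂ) *
      ∑ π : Perm (Fin d × Fin k), cf row π * ∏ a, B (fun b => col (π (a, b))) := by
  rw [v0, F_apply, map_sum]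
  have h1 : ∀ π : Perm (Fin d × Fin k),
      Φ d (phi k N B) (cf row π • G0 k d N (fun p => Pi.single (col (π p)) 1)) =
      ∑ τ : Fin d → Perm (Fin k), cf row (π * prodCongrRight τ) *
        ∏ a, B (fun b => col ((π * prodCongrRight τ) (a, b))) := by
    intro π
    rw [map_smul, G0_apply, Φ_tprod]
    have h2 : ∀ a : Fin d, phi k N B (exteriorPower.ιMulti ℂ k
        (fun b => Pi.single (col (π (a, b))) 1)) =
        ∑ τ : Perm (Fin k), ((Perm.sign τ : ℤ) : ℂ) * B (fun b => col (π (a, τ b))) :=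
      fun a => phi_basis B (fun b => col (π (a, b)))
    simp only [h2]
    rw [Finset.prod_univ_sum, Fintype.piFinset_univ, smul_eq_mul, Finset.mul_sum]
    refine Finset.sum_congr rfl fun τ _ => ?_
    rw [cf_mul, Finset.prod_mul_distrib, mul_assoc]
    rfl
  simp only [h1]
  rw [Finset.sum_comm]
  have h3 : ∀ τ : Fin d → Perm (Fin k), ∑ π : Perm (Fin d × Fin k),
      cf row (π * prodCongrRight τ) * ∏ a, B (fun b => col ((π * prodCongrRight τ) (a, b))) =
      ∑ π : Perm (Fin d × Fin k), cf row π * ∏ a, B (fun b => col (π (a, b))) := by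
    intro τ
    exact Equiv.sum_comp (Equiv.mulRight (prodCongrRight τ))
      (fun π : Perm (Fin d × Fin k) => cf row π * ∏ a, B (fun b => col (π (a, b))))
  simp only [h3]
  rw [Finset.sum_const, nsmul_eq_mul, Finset.card_univ]

variable {L : ℕ} {c : Fin L → ℕ}

/-- Splitting of the positions in two halves. -/
def JJ (e : Fin d × Fin m ≃ H c) : Fin d × Fin (m + m) ≃ H c ⊕ H c :=
  ((Equiv.prodCongr (Equiv.refl _) finSumFinEquiv.symm).trans
    (Equiv.prodSumDistrib _ _ _)).trans (Equiv.sumCongr e e)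

lemma JJ_castAdd (e : Fin d × Fin m ≃ H c) (a : Fin d) (r : Fin m) :
    JJ e (a, Fin.castAdd m r) = Sum.inl (e (a, r)) := by
  simp [JJ]

lemma JJ_natAdd (e : Fin d × Fin m ≃ H c) (a : Fin d) (r : Fin m) :
    JJ e (a, Fin.natAdd m r) = Sum.inr (e (a, r)) := by
  simp only [JJ, Equiv.trans_apply, Equiv.prodCongr_apply, Prod.map_apply, Equiv.refl_apply,
    finSumFinEquiv_symm_apply_natAdd]
  rfl

lemma JJ_symm_inl (e : Fin d × Fin m ≃ H c) (x : H c) :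
    (JJ e).symm (Sum.inl x) = ((e.symm x).1, Fin.castAdd m (e.symm x).2) := by
  rw [Equiv.symm_apply_eq, JJ_castAdd]; simp

lemma JJ_symm_inr (e : Fin d × Fin m ≃ H c) (x : H c) :
    (JJ e).symm (Sum.inr x) = ((e.symm x).1, Fin.natAdd m (e.symm x).2) := by
  rw [Equiv.symm_apply_eq, JJ_natAdd]; simp

/-- Column of a cell. -/
def cl : H c ⊕ H c → ℕ := Sum.elim (fun x => 2 * (x.1 : ℕ)) (fun x => 2 * (x.1 : ℕ) + 1)

/-- The form on basis vectors. -/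
def bb (s t : ℕ) : ℂ := if s % 2 = 0 ∧ t = s + 1 then 1 else 0

lemma bb_eq_zero {s t : ℕ} (h : ¬ (s % 2 = 0 ∧ t = s + 1)) : bb s t = 0 := if_neg h

lemma bb_eq_one {s t : ℕ} (h : s % 2 = 0 ∧ t = s + 1) : bb s t = 1 := if_pos h

lemma bb_cl (y z : H c ⊕ H c) : bb (cl y) (cl z) = BB y z := by
  rcases y with y | y <;> rcases z with z | z
  · exact bb_eq_zero (by simp only [cl, Sum.elim_inl]; omega)
  · by_cases h : y.1 = z.1
    · have hB : BB (Sum.inl y) (Sum.inr z) = 1 := if_pos h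
      rw [hB]
      rw [Fin.ext_iff] at h
      exact bb_eq_one (by simp only [cl, Sum.elim_inl, Sum.elim_inr]; omega)
    · have hB : BB (Sum.inl y) (Sum.inr z) = 0 := if_neg h
      rw [hB]
      rw [Fin.ext_iff] at h
      exact bb_eq_zero (by simp only [cl, Sum.elim_inl, Sum.elim_inr]; omega)
  · exact bb_eq_zero (by simp only [cl, Sum.elim_inl, Sum.elim_inr]; omega)
  · exact bb_eq_zero (by simp only [cl, Sum.elim_inr]; omega)

lemma Φ_v0_ne (e : Fin d × Fin m ≃ H c)
    (he : ∀ x y : H c, x.1 = y.1 → (e.symm x).1 = (e.symm y).1 → x = y)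
    (row : Fin d × Fin (m + m) → ℕ) (col : Fin d × Fin (m + m) → Fin N)
    (hrow : ∀ p, row p = rw' (JJ e p)) (hcol : ∀ p, (col p : ℕ) = cl (JJ e p)) :
    Φ d (phi (m + m) N (fun f => ∏ r : Fin m, bb (f (Fin.castAdd m r)) (f (Fin.natAdd m r))))
      (v0 row col) ≠ 0 := by
  rw [Φ_v0]
  refine mul_ne_zero (by exact_mod_cast Fintype.card_ne_zero) ?_
  have key : ∀ π : Perm (Fin d × Fin (m + m)), cf row π * ∏ a, ∏ r : Fin m,
      bb (col (π (a, Fin.castAdd m r))) (col (π (a, Fin.natAdd m r))) =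
      TT (fun x => ((e.symm x).1 : ℕ)) ((JJ e).permCongr π) := by
    intro π
    have e1 : ∏ p : Fin d × Fin (m + m), ((p.1 : ℕ) : ℂ) ^ row (π p) =
        ∏ x : H c, ((((e.symm x).1 : ℕ) : ℂ) ^ rw' ((JJ e).permCongr π (Sum.inl x)) *
        (((e.symm x).1 : ℕ) : ℂ) ^ rw' ((JJ e).permCongr π (Sum.inr x))) := by
      rw [← Equiv.prod_comp (JJ e).symm, Fintype.prod_sum_type, ← Finset.prod_mul_distrib]
      refine Finset.prod_congr rfl fun x _ => ?_
      rw [hrow, hrow, Equiv.permCongr_apply, Equiv.permCongr_apply, JJ_symm_inl, JJ_symm_inr]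
    have e2 : ∏ a, ∏ r : Fin m,
        bb (col (π (a, Fin.castAdd m r))) (col (π (a, Fin.natAdd m r))) =
        ∏ x : H c, BB ((JJ e).permCongr π (Sum.inl x)) ((JJ e).permCongr π (Sum.inr x)) := by
      rw [← Fintype.prod_prod_type' (fun a r =>
        bb (col (π (a, Fin.castAdd m r))) (col (π (a, Fin.natAdd m r)))),
        ← Equiv.prod_comp e.symm]
      refine Finset.prod_congr rfl fun x _ => ?_
      rw [hcol, hcol, bb_cl, Equiv.permCongr_apply, Equiv.permCongr_apply, JJ_symm_inl,
        JJ_symm_inr]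
    rw [cf, TT, e1, e2, Perm.sign_permCongr]
  simp only [key]
  rw [Equiv.sum_comp (JJ e).permCongr (TT (fun x => ((e.symm x).1 : ℕ)))]
  refine sum_TT_ne _ ?_
  intro x y hxy hl
  exact he x y hxy (Fin.ext hl)

end functional

/-! ### Combinatorics of the partition -/

section combi

variable {L m : ℕ} {c : Fin L → ℕ}

lemma exists_fill (hc : ∀ i, c i ≤ d) (hsum : ∑ i, c i = m * d) :
    ∃ e : Fin d × Fin m ≃ H c,
      ∀ x y : H c, x.1 = y.1 → (e.symm x).1 = (e.symm y).1 → x = y := by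
  let E : Fin d × Fin m ≃ H c := ((Equiv.prodComm _ _).trans finProdFinEquiv).trans
    ((finCongr hsum.symm).trans finSigmaFinEquiv.symm)
  refine ⟨E, ?_⟩
  have hE : ∀ x : H c, (finSigmaFinEquiv x : ℕ) = (E.symm x).1 + d * (E.symm x).2 := by
    intro x
    obtain ⟨q, rfl⟩ := E.surjective x
    simp [E]
  rintro ⟨i, j⟩ ⟨i', j'⟩ hxy hl
  simp only at hxy
  subst hxy
  have h1 := hE ⟨i, j⟩
  have h2 := hE ⟨i, j'⟩
  rw [finSigmaFinEquiv_apply] at h1 h2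
  simp only at h1 h2
  rw [hl] at h1
  set s := ∑ i_1 : Fin i, c (Fin.castLE i.2.le i_1)
  have hj := j.2
  have hj' := j'.2
  have hci := hc i
  have hmod : (s + j) ≡ (s + j') [MOD d] := by
    rw [h1, h2]
    simp [Nat.ModEq]
  have hmod2 : (j : ℕ) ≡ j' [MOD d] := Nat.ModEq.add_left_cancel' s hmod
  have : (j : ℕ) = j' := Nat.ModEq.eq_of_lt_of_lt hmod2 (by omega) (by omega)
  congr 1
  exact Fin.ext this

end combi

lemma main (m d N : ℕ) (lam : ℕ → ℕ) (hanti : Antitone lam)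
    (heven : ∀ i, Even (lam i))
    (hsum : ∑ i ∈ Finset.range d, lam i = d * (m + m))
    (hN : lam 0 ≤ N) :
    ∃ v : ⨂[ℂ]^d (⋀[ℂ]^(m + m) (Fin N → ℂ)), v ≠ 0 ∧
      (∀ σ : Equiv.Perm (Fin d),
        PiTensorProduct.reindex ℂ (fun _ : Fin d => ⋀[ℂ]^(m + m) (Fin N → ℂ)) σ v = v) ∧
      (∀ g : Matrix (Fin N) (Fin N) ℂ, (∀ i j : Fin N, j < i → g i j = 0) →
        (∀ i, g i i = 1) →
        PiTensorProduct.map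
          (fun _ : Fin d => exteriorPowerMap (m + m) (Matrix.toLin' g)) v = v) ∧
      (∀ t : Fin N → ℂ, (∀ i, t i ≠ 0) →
        PiTensorProduct.map
          (fun _ : Fin d => exteriorPowerMap (m + m) (Matrix.toLin' (Matrix.diagonal t))) v =
          (∏ i : Fin N,
            t i ^ (((Finset.range d).filter fun j => (i : ℕ) + 1 ≤ lam j).card)) • v) := by
  obtain ⟨L, hL⟩ := heven 0
  have hle : ∀ j, lam j ≤ L + L := fun j => hL ▸ hanti (Nat.zero_le j)
  let C : ℕ → ℕ := fun i => ((Finset.range d).filter fun j => i + 1 ≤ lam j).card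
  have hCanti : Antitone C := by
    intro i i' h
    refine Finset.card_le_card ?_
    intro j hj
    simp only [Finset.mem_filter] at hj ⊢
    exact ⟨hj.1, by omega⟩
  let c : Fin L → ℕ := fun i => C (2 * i)
  have hCodd : ∀ i, C (2 * i + 1) = C (2 * i) := by
    intro i
    simp only [C]
    congr 1
    refine Finset.filter_congr fun j _ => ?_
    obtain ⟨r, hr⟩ := heven j
    omega
  have hCbig : ∀ i, L + L ≤ i → C i = 0 := by
    intro i hi
    simp only [C]
    rw [Finset.card_eq_zero, Finset.filter_eq_empty_iff]
    intro j _
    have := hle j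
    omega
  have hc : ∀ i, c i ≤ d := fun i => (Finset.card_filter_le _ _).trans (by simp)
  have hcsum : ∑ i, c i = m * d := by
    have h1 : ∑ i, c i = ∑ i ∈ Finset.range L, C (2 * i) := by
      rw [Finset.sum_range]
    have h2 : ∑ i ∈ Finset.range L, C (2 * i) = ∑ j ∈ Finset.range d, lam j / 2 := by
      simp only [C, Finset.card_filter]
      rw [Finset.sum_comm]
      refine Finset.sum_congr rfl fun j _ => ?_
      rw [← Finset.card_filter]
      have h3 : (Finset.range L).filter (fun i => 2 * i + 1 ≤ lam j) =
          Finset.range (lam j / 2) := by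
        ext i
        simp only [Finset.mem_filter, Finset.mem_range]
        obtain ⟨r, hr⟩ := heven j
        have := hle j
        omega
      rw [h3, Finset.card_range]
    have h4 : 2 * ∑ j ∈ Finset.range d, lam j / 2 = ∑ j ∈ Finset.range d, lam j := by
      rw [Finset.mul_sum]
      refine Finset.sum_congr rfl fun j _ => ?_
      obtain ⟨r, hr⟩ := heven j
      omega
    rw [h1, h2]
    rw [hsum] at h4
    nlinarith
  obtain ⟨e, he⟩ := exists_fill hc hcsum
  have hcl : ∀ y : H c ⊕ H c, cl y < N := by
    rintro (y | y)
    · have := y.1.2; simp only [cl, Sum.elim_inl]; omega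
    · have := y.1.2; simp only [cl, Sum.elim_inr]; omega
  let row : Fin d × Fin (m + m) → ℕ := fun p => rw' (JJ e p)
  let col : Fin d × Fin (m + m) → Fin N := fun p => ⟨cl (JJ e p), hcl _⟩
  have hne := Φ_v0_ne e he row col (fun _ => rfl) (fun _ => rfl)
  refine ⟨sy (v0 row col), ?_, reindex_sy _, ?_, ?_⟩
  · intro h0
    have h1 := Φ_sy (phi (m + m) N
      (fun f => ∏ r : Fin m, bb (f (Fin.castAdd m r)) (f (Fin.natAdd m r)))) (v0 row col)
    rw [h0, map_zero] at h1
    exact mul_ne_zero (by exact_mod_cast Fintype.card_ne_zero) hne h1.symm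
  · intro g hg hg1
    rw [map_sy, unip_v0 row col ?_ g hg hg1]
    intro p s hs
    have hs' : (s : ℕ) < cl (JJ e p) := hs
    -- the column pair of `s` contains a cell in the row of `p`
    obtain ⟨x, hx1, hx2⟩ : ∃ x : H c, rw' (JJ e p) = x.2 ∧ cl (JJ e p) ≤ 2 * x.1 + 1 := by
      rcases JJ e p with y | y
      · exact ⟨y, rfl, by simp [cl]⟩
      · exact ⟨y, rfl, by simp [cl]⟩
    have hxL := x.1.2
    have hsL : (s : ℕ) / 2 < L := by omega
    have hlt : (x.2 : ℕ) < c ⟨(s : ℕ) / 2, hsL⟩ :=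
      lt_of_lt_of_le x.2.2 (hCanti (by simp only; omega))
    let y : H c := ⟨⟨(s : ℕ) / 2, hsL⟩, ⟨x.2, hlt⟩⟩
    rcases Nat.mod_two_eq_zero_or_one s with hs2 | hs2
    · refine ⟨(JJ e).symm (Sum.inl y), ?_, ?_⟩
      · simp only [row, Equiv.apply_symm_apply, hx1]
        simp [rw', y]
      · apply Fin.ext
        simp only [col, Equiv.apply_symm_apply]
        simp only [cl, Sum.elim_inl, y]
        omega
    · refine ⟨(JJ e).symm (Sum.inr y), ?_, ?_⟩
      · simp only [row, Equiv.apply_symm_apply, hx1]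
        simp [rw', y]
      · apply Fin.ext
        simp only [col, Equiv.apply_symm_apply]
        simp only [cl, Sum.elim_inr, y]
        omega
  · intro t _
    rw [map_sy, diag_v0, sy_smul]
    congr 1
    let T : ℕ → ℂ := fun i => if h : i < N then t ⟨i, h⟩ else 1
    have hT : ∀ i : Fin N, t i = T i := by
      intro i; simp [T]
    have h1 : ∏ p, t (col p) = ∏ i ∈ Finset.range L, (T (2 * i) ^ C (2 * i) *
        T (2 * i + 1) ^ C (2 * i + 1)) := by
      simp only [hT]
      change ∏ p, T (cl (JJ e p)) = _
      rw [Equiv.prod_comp (JJ e) (fun y => T (cl y)), Fintype.prod_sum_type,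
        ← Finset.prod_mul_distrib, Fintype.prod_sigma, Finset.prod_range]
      refine Finset.prod_congr rfl fun i _ => ?_
      simp only [cl, Sum.elim_inl, Sum.elim_inr, Finset.prod_const, Finset.card_univ,
        Fintype.card_fin, hCodd, c, mul_pow]
    have h2 : ∀ n, ∏ i ∈ Finset.range n, (T (2 * i) ^ C (2 * i) *
        T (2 * i + 1) ^ C (2 * i + 1)) = ∏ i ∈ Finset.range (n + n), T i ^ C i := by
      intro n
      induction n with
      | zero => simp
      | succ n ih =>
        rw [Finset.prod_range_succ, ih, show n + 1 + (n + 1) = (n + n + 1) + 1 by ring,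
          Finset.prod_range_succ _ (n + n + 1), Finset.prod_range_succ _ (n + n), two_mul, mul_assoc]
    rw [h1, h2]
    have h3 : ∏ i : Fin N, t i ^ C i = ∏ i ∈ Finset.range N, T i ^ C i := by
      rw [Finset.prod_range]
      simp only [hT]
    refine Eq.trans ?_ h3.symm
    refine Finset.prod_subset (by intro i; simp only [Finset.mem_range]; omega) ?_
    intro i _ hi
    rw [hCbig i (by simpa using hi), pow_zero]

end Wein

/-- **Weintraub's conjecture, wedge-power form** (Theorem of Section 3).
Let `k` be a positive even integer, `d` a positive integer, and `λ` (given by the antitone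
function `lam`, with `lam i = 0` for `i ≥ d`, so `λ` has at most `d` parts) a partition of
`d*k` all of whose parts are even.  Let `N ≥ λ₁` and `W = ℂ^N`.  Then there is a nonzero
vector in `(⋀^k W)^{⊗ d}` which is invariant under the permutations of the tensor factors,
fixed by the maps induced by all upper triangular unipotent matrices, and rescaled by
`∏ tᵢ^{λ*ᵢ}` by the map induced by `diag(t₁,…,t_N)`; i.e. a nonzero `S_d`-invariant highest
weight vector of weight `λ*`, the conjugate partition of `λ`.  (Equivalently, the Schur module
`S_{λ*} W` occurs in `S^d(⋀^k W)`.) -/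
theorem stmt_0 (k d N : ℕ) (hk : 0 < k) (hkeven : Even k) (hd : 0 < d)
    (lam : ℕ → ℕ) (hanti : Antitone lam)
    (hparts : ∀ i, d ≤ i → lam i = 0)
    (heven : ∀ i, Even (lam i))
    (hsum : ∑ i ∈ Finset.range d, lam i = d * k)
    (hN : lam 0 ≤ N) :
    ∃ v : ⨂[ℂ]^d (⋀[ℂ]^k (Fin N → ℂ)), v ≠ 0 ∧
      (∀ σ : Equiv.Perm (Fin d),
        PiTensorProduct.reindex ℂ (fun _ : Fin d => ⋀[ℂ]^k (Fin N → ℂ)) σ v = v) ∧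
      (∀ g : Matrix (Fin N) (Fin N) ℂ, (∀ i j : Fin N, j < i → g i j = 0) →
        (∀ i, g i i = 1) →
        PiTensorProduct.map
          (fun _ : Fin d => exteriorPowerMap k (Matrix.toLin' g)) v = v) ∧
      (∀ t : Fin N → ℂ, (∀ i, t i ≠ 0) →
        PiTensorProduct.map
          (fun _ : Fin d => exteriorPowerMap k (Matrix.toLin' (Matrix.diagonal t))) v =
          (∏ i : Fin N,
            t i ^ (((Finset.range d).filter fun j => (i : ℕ) + 1 ≤ lam j).card)) • v) := by
  obtain ⟨m, rfl⟩ := hkeven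
  exact Wein.main m d N lam hanti heven hsum hN

end
end

section
/- Let d ≥ 1 and let R = ℂ[x_1,…,x_d]. Let V ⊂ R be the space of homogeneous linear polynomials and K ⊂ V a hyperplane (a codimension-one subspace of V). For integers p, q ≥ 0, let S^pK ⊂ R denote the linear span of all products of p elements of K, and let R_q denote the space of homogeneous polynomials of degree q. Let Y : R ⊗ R → R ⊗ R be the linear map determined by Y(f ⊗ g) = Σ_{i=1}^d (x_i·f) ⊗ (∂g/∂x_i). If an element w ∈ S^pK ⊗ R_q satisfies Y(w) = 0, then w ∈ S^pK ⊗ S^qK. -/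
open scoped TensorProduct

noncomputable section

/-- `S^p K`: the linear span of all products of `p` elements of `K`, inside the polynomial
ring (for `p = 0` this is the span of `1`, i.e. the constants). -/
def prodSpan (d p : ℕ) (K : Submodule ℂ (MvPolynomial (Fin d) ℂ)) :
    Submodule ℂ (MvPolynomial (Fin d) ℂ) :=
  Submodule.span ℂ {f | ∃ v : Fin p → MvPolynomial (Fin d) ℂ,
    (∀ i, v i ∈ K) ∧ f = ∏ i, v i}

open MvPolynomial in
lemma prodSpan_eq_pow (d p : ℕ) (K : Submodule ℂ (MvPolynomial (Fin d) ℂ)) :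
    prodSpan d p K = K ^ p := by
  rw [Submodule.pow_eq_span_pow_set, prodSpan]
  congr 1
  ext f
  simp only [Set.mem_ofPred_eq, Set.mem_pow]
  constructor
  · rintro ⟨v, hv, rfl⟩
    exact ⟨fun i => ⟨v i, hv i⟩, by simp [List.prod_ofFn]⟩
  · rintro ⟨v, rfl⟩
    exact ⟨fun i => v i, fun i => (v i).2, by simp [List.prod_ofFn]⟩

open MvPolynomial in
/-- The directional derivative along `a`. -/
def dirD (d : ℕ) (a : Fin d → ℂ) :
    Derivation ℂ (MvPolynomial (Fin d) ℂ) (MvPolynomial (Fin d) ℂ) :=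
  mkDerivation ℂ (fun i => C (a i))

open MvPolynomial in
lemma dirD_X (d : ℕ) (a : Fin d → ℂ) (i : Fin d) : dirD d a (X i) = C (a i) := by
  simp [dirD, mkDerivation_X]

open MvPolynomial in
lemma dirD_eq (d : ℕ) (a : Fin d → ℂ) (f : MvPolynomial (Fin d) ℂ) :
    dirD d a f = ∑ i, a i • pderiv i f := by
  have hs : ∀ g, (∑ i, a i • pderiv i : Derivation ℂ (MvPolynomial (Fin d) ℂ) _) g =
      ∑ i, a i • pderiv i g := by
    intro g
    have := congrFun (map_sum (Derivation.coeFnAddMonoidHom (R := ℂ)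
      (A := MvPolynomial (Fin d) ℂ) (M := MvPolynomial (Fin d) ℂ))
      (fun i => a i • pderiv i) Finset.univ) g
    rw [Finset.sum_apply] at this
    exact this
  have : dirD d a = ∑ i, a i • pderiv i := by
    apply derivation_ext
    intro j
    rw [dirD_X, hs]
    simp only [pderiv_X]
    simp [Pi.single_apply, smul_eq_C_mul]
  rw [this, hs]

open MvPolynomial in
lemma dirD_pow_zero (d : ℕ) (a : Fin d → ℂ) (K : Submodule ℂ (MvPolynomial (Fin d) ℂ))
    (hK : ∀ k ∈ K, dirD d a k = 0) (p : ℕ) : ∀ f ∈ K ^ p, dirD d a f = 0 := by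
  intro f hf
  induction hf using Submodule.pow_induction_on_left' with
  | algebraMap r => simp
  | add x y i hx hy h1 h2 => rw [map_add, h1, h2, add_zero]
  | mem_mul m hm i x hx ih => rw [Derivation.leibniz, ih, hK m hm]; simp

open MvPolynomial in
lemma eq_zero_of_dvd (d : ℕ) (a : Fin d → ℂ) (j : Fin d) (hj : a j ≠ 0)
    (u : MvPolynomial (Fin d) ℂ) (hu : X j ∣ u) (hD : dirD d a u = 0) : u = 0 := by
  by_contra h0
  have hp : Prime (X j : MvPolynomial (Fin d) ℂ) := X_prime
  have hf := FiniteMultiplicity.of_prime_left hp h0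
  obtain ⟨c, hc, hnd⟩ := hf.exists_eq_pow_mul_and_not_dvd
  generalize multiplicity (X j) u = n at hc
  subst hc
  rcases n with _ | n
  · exact hnd (by simpa using hu)
  · rw [Derivation.leibniz, Derivation.leibniz_pow, dirD_X] at hD
    simp only [smul_eq_mul, Nat.add_sub_cancel, nsmul_eq_mul] at hD
    have h2 : X j ^ n * (X j * dirD d a c + C ((n + 1 : ℂ) * a j) * c) = 0 := by
      rw [← hD]; simp only [map_mul, map_add, map_natCast, map_one]; push_cast; ring
    have h3 := (mul_eq_zero.mp h2).resolve_left (pow_ne_zero _ hp.ne_zero)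
    have hne : (n + 1 : ℂ) * a j ≠ 0 := mul_ne_zero (by exact_mod_cast n.succ_ne_zero) hj
    apply hnd
    refine ⟨C (-((n + 1 : ℂ) * a j)⁻¹) * dirD d a c, ?_⟩
    have h4 : C (((n + 1 : ℂ) * a j)⁻¹) * C ((n + 1 : ℂ) * a j) =
        (1 : MvPolynomial (Fin d) ℂ) := by
      rw [← C_mul, inv_mul_cancel₀ hne, C_1]
    rw [C_neg]
    linear_combination C (((n + 1 : ℂ) * a j)⁻¹) * h3 - c * h4

open MvPolynomial in
lemma ker_dirD_le (d q : ℕ) (a : Fin d → ℂ) (j : Fin d) (hj : a j ≠ 0)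
    (K : Submodule ℂ (MvPolynomial (Fin d) ℂ))
    (hK : ∀ k ∈ K, dirD d a k = 0)
    (hK' : ∀ i, (X i - C (a i / a j) * X j : MvPolynomial (Fin d) ℂ) ∈ K)
    (f : MvPolynomial (Fin d) ℂ) (hf : f ∈ homogeneousSubmodule (Fin d) ℂ q)
    (hD : dirD d a f = 0) : f ∈ K ^ q := by
  let φ : MvPolynomial (Fin d) ℂ →ₐ[ℂ] MvPolynomial (Fin d) ℂ :=
    aeval (fun i => X i - C (a i / a j) * X j)
  have h1 : φ f ∈ K ^ q := by
    rw [← homogeneousSubmodule_one_pow] at hf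
    have h : φ f ∈ ((homogeneousSubmodule (Fin d) ℂ 1) ^ q).map φ.toLinearMap := ⟨f, hf, rfl⟩
    rw [Submodule.map_pow] at h
    refine (pow_le_pow_left' ?_ q : _ ≤ K ^ q) h
    rw [homogeneousSubmodule_one_eq_span_X, Submodule.map_span_le]
    rintro _ ⟨i, rfl⟩
    simpa [φ] using hK' i
  have h2 : X j ∣ f - φ f := by
    rw [← Ideal.mem_span_singleton, ← Ideal.Quotient.mk_eq_mk_iff_sub_mem]
    have : (Ideal.Quotient.mkₐ ℂ (Ideal.span {(X j : MvPolynomial (Fin d) ℂ)})) =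
        (Ideal.Quotient.mkₐ ℂ (Ideal.span {(X j : MvPolynomial (Fin d) ℂ)})).comp φ := by
      apply algHom_ext
      intro i
      simp only [AlgHom.comp_apply, Ideal.Quotient.mkₐ_eq_mk, φ, aeval_X]
      rw [Ideal.Quotient.mk_eq_mk_iff_sub_mem, Ideal.mem_span_singleton]
      exact ⟨C (a i / a j), by ring⟩
    exact congrArg (fun g => g f) this
  have h3 : f - φ f = 0 := by
    apply eq_zero_of_dvd d a j hj _ h2
    rw [map_sub, hD, dirD_pow_zero d a K hK q _ h1, sub_zero]
  rw [sub_eq_zero.mp h3]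
  exact h1

open MvPolynomial in
lemma exists_dir (d : ℕ) (hd : 0 < d)
    (K : Submodule ℂ (MvPolynomial (Fin d) ℂ))
    (hKV : K ≤ MvPolynomial.homogeneousSubmodule (Fin d) ℂ 1)
    (hKdim : Module.finrank ℂ K = d - 1) :
    ∃ (a : Fin d → ℂ) (j : Fin d), a j ≠ 0 ∧ (∀ k ∈ K, dirD d a k = 0) ∧
      ∀ i, (X i - C (a i / a j) * X j : MvPolynomial (Fin d) ℂ) ∈ K := by
  let L : (Fin d → ℂ) →ₗ[ℂ] MvPolynomial (Fin d) ℂ :=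
    Fintype.linearCombination ℂ (fun i => (X i : MvPolynomial (Fin d) ℂ))
  have hLs : ∀ i, L (Pi.single i 1) = X i := by
    intro i
    simp [L, Fintype.linearCombination_apply_single]
  have hLi : Function.Injective L := by
    apply LinearIndependent.fintypeLinearCombination_injective
    exact linearIndependent_X (Fin d) ℂ
  have hLr : K ≤ LinearMap.range L := by
    refine hKV.trans ?_
    rw [homogeneousSubmodule_one_eq_span_X, Fintype.range_linearCombination]
  let K' := K.comap L
  have hKm : K'.map L = K := Submodule.map_comap_eq_of_le hLr
  have hK'dim : Module.finrank ℂ K' = d - 1 := by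
    rw [← hKdim, ← hKm]
    exact LinearEquiv.finrank_eq (Submodule.equivMapOfInjective L hLi K')
  have hlt : K' < ⊤ := by
    rw [lt_top_iff_ne_top]
    intro h
    rw [h, finrank_top, Module.finrank_fin_fun] at hK'dim
    omega
  obtain ⟨f, hf0, hfK⟩ := Submodule.exists_le_ker_of_lt_top K' hlt
  have hker : K' = LinearMap.ker f := by
    apply Submodule.eq_of_le_of_finrank_le hfK
    have := Module.Dual.finrank_ker_add_one_of_ne_zero hf0
    rw [Module.finrank_fin_fun] at this
    omega
  let a : Fin d → ℂ := fun i => f (Pi.single i 1)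
  obtain ⟨j, hj⟩ : ∃ j, a j ≠ 0 := by
    by_contra h
    push Not at h
    apply hf0
    apply LinearMap.pi_ext'
    intro i
    ext
    simpa using h i
  refine ⟨a, j, hj, ?_, ?_⟩
  · intro k hk
    obtain ⟨c, rfl⟩ := hLr hk
    have hc : f c = 0 := hfK hk
    have key : ((dirD d a).toLinearMap ∘ₗ L) = (Algebra.linearMap ℂ (MvPolynomial (Fin d) ℂ)) ∘ₗ f := by
      apply LinearMap.pi_ext'
      intro i
      ext1
      simp [hLs, dirD_X, a, algebraMap_eq]
    have := congrArg (fun g => g c) key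
    simpa [hc] using this
  · intro i
    have : (X i - C (a i / a j) * X j : MvPolynomial (Fin d) ℂ) =
        L (Pi.single i 1 - (a i / a j) • Pi.single j 1) := by
      rw [map_sub, map_smul, hLs, hLs, smul_eq_C_mul]
    rw [this]
    change _ ∈ K'
    rw [hker, LinearMap.mem_ker, map_sub, map_smul, smul_eq_mul]
    change a i - a i / a j * a j = 0
    field_simp
    ring

lemma tensor_ker {M N : Type*} [AddCommGroup M] [Module ℂ M] [AddCommGroup N] [Module ℂ N]
    (A : Submodule ℂ M) (B C : Submodule ℂ N) (D : N →ₗ[ℂ] N)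
    (hC : ∀ x ∈ B, D x = 0 → x ∈ C) (w : M ⊗[ℂ] N)
    (hw : w ∈ LinearMap.range (TensorProduct.mapIncl A B))
    (hD : D.lTensor M w = 0) : w ∈ LinearMap.range (TensorProduct.mapIncl A C) := by
  obtain ⟨z, rfl⟩ := hw
  let DB : B →ₗ[ℂ] N := D ∘ₗ B.subtype
  have h1 : (A.subtype.rTensor N) (DB.lTensor A z) = 0 := by
    rw [← hD]
    simp only [TensorProduct.mapIncl, LinearMap.lTensor, LinearMap.rTensor, ← LinearMap.comp_apply,
      ← TensorProduct.map_comp]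
    rfl
  have h2 : DB.lTensor A z = 0 := by
    have := Module.Flat.rTensor_preserves_injective_linearMap (M := N) A.subtype
      A.injective_subtype
    exact this (by rw [h1, map_zero])
  have hex : Function.Exact (LinearMap.ker DB).subtype DB := LinearMap.exact_subtype_ker_map DB
  obtain ⟨z', rfl⟩ := (Module.Flat.lTensor_exact A hex z).mp h2
  let g : LinearMap.ker DB →ₗ[ℂ] C :=
    (B.subtype ∘ₗ (LinearMap.ker DB).subtype).codRestrict C
      (fun x => hC _ x.1.2 x.2)
  refine ⟨g.lTensor A z', ?_⟩
  simp only [TensorProduct.mapIncl, LinearMap.lTensor, ← LinearMap.comp_apply,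
      ← TensorProduct.map_comp]
  rfl

/-- Section 2.2 (key step of the Proposition): let `R = ℂ[x_1,…,x_d]`, let `K` be a
hyperplane (a codimension-one subspace) of the space `V` of homogeneous linear polynomials,
and let `Y : R ⊗ R → R ⊗ R` be the map `f ⊗ g ↦ ∑ᵢ (xᵢ·f) ⊗ (∂g/∂xᵢ)`.  If
`w ∈ S^pK ⊗ R_q` (with `R_q` the homogeneous polynomials of degree `q`) satisfies
`Y(w) = 0`, then `w ∈ S^pK ⊗ S^qK`. -/
theorem stmt_9 (d : ℕ) (hd : 0 < d) (p q : ℕ)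
    (K : Submodule ℂ (MvPolynomial (Fin d) ℂ))
    (hKV : K ≤ MvPolynomial.homogeneousSubmodule (Fin d) ℂ 1)
    (hKdim : Module.finrank ℂ K = d - 1)
    (w : MvPolynomial (Fin d) ℂ ⊗[ℂ] MvPolynomial (Fin d) ℂ)
    (hw : w ∈ LinearMap.range (TensorProduct.mapIncl (prodSpan d p K)
      (MvPolynomial.homogeneousSubmodule (Fin d) ℂ q)))
    (hY : (∑ i : Fin d,
      TensorProduct.map (LinearMap.mulLeft ℂ (MvPolynomial.X i))
        (MvPolynomial.pderiv i).toLinearMap) w = 0) :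
    w ∈ LinearMap.range (TensorProduct.mapIncl (prodSpan d p K) (prodSpan d q K)) := by
  obtain ⟨a, j, hj, hK, hK'⟩ := exists_dir d hd K hKV hKdim
  refine tensor_ker (prodSpan d p K) _ (prodSpan d q K) (dirD d a).toLinearMap ?_ w hw ?_
  · intro x hx hDx
    rw [prodSpan_eq_pow]
    exact ker_dirD_le d q a j hj K hK hK' x hx hDx
  · have h0 : (dirD d a).toLinearMap.rTensor (MvPolynomial (Fin d) ℂ) ((∑ i : Fin d,
      TensorProduct.map (LinearMap.mulLeft ℂ (MvPolynomial.X i))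
        (MvPolynomial.pderiv i).toLinearMap) w) = 0 := by rw [hY, map_zero]
    rw [← h0]
    obtain ⟨z, rfl⟩ := hw
    simp only [← LinearMap.comp_apply]
    congr 1
    apply TensorProduct.ext'
    rintro ⟨f, hf⟩ ⟨g, hg⟩
    rw [prodSpan_eq_pow] at hf
    have hDf := dirD_pow_zero d a K hK p f hf
    simp only [LinearMap.comp_apply, TensorProduct.mapIncl, TensorProduct.map_tmul,
      Submodule.subtype_apply, LinearMap.lTensor_tmul, LinearMap.sum_apply, map_sum,
      LinearMap.rTensor_tmul, LinearMap.mulLeft_apply, Derivation.coeFn_coe]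
    rw [dirD_eq, TensorProduct.tmul_sum]
    refine Finset.sum_congr rfl fun i _ => ?_
    rw [Derivation.leibniz, hDf, dirD_X, smul_zero, zero_add, smul_eq_mul, mul_comm,
      ← MvPolynomial.smul_eq_C_mul, TensorProduct.smul_tmul]
end
end
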